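/- Let g and h be restricted Lie algebras over k and ρ: g → End_k(h) a linear map. The semiproduct h ⋊_ρ g (defined on the vector space h ⊕ g with bracket [a+x, b+y] := [a,b]_h + ρ_x(b) − ρ_y(a) + [x,y]_g and restricted map (a+x)^[p] := a^[p] + x^[p] + Σ_{i=1}^{p−1} s_i(a,x), where i·s_i(a,x) is the coefficient of λ^{i−1} in a·(ad(λa+x))^{p−1}) is a well-defined restricted Lie algebra if and only if ρ is an algebraic representation of g on h. -/

import Mathlib

set_option linter.unusedSectionVars false

namespace PD1

section Defs

variable (p : ℕ) [Fact (Nat.Prime p)] (k : Type) [Field k] [CharP k p]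
variable (V : Type) [AddCommGroup V] [Module k V]

/-- The word in the right multiplication operators `ad x`, `ad y` (prescribed by
`f : Fin (p−1) → Bool`) applied to `x`; here `B` is the Lie bracket, so that
`B.flip w = (· ↦ [·, w])` is the right adjoint action of `w`. -/
noncomputable def sWord (B : V →ₗ[k] V →ₗ[k] V) (x y : V) (f : Fin (p - 1) → Bool) : V :=
  ((List.ofFn (fun j => if f j then B.flip x else B.flip y)).prod : Module.End k V) x

/-- `s_i(x, y)`, where `i·s_i(x, y)` is the coefficient of `λ^{i−1}` in
`x·(ad(λx+y))^{p−1}`: expanding the operator power, this coefficient is the sum of all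
words of length `p−1` in `ad x`, `ad y` with exactly `i−1` occurrences of `ad x`,
applied to `x` (and `i` is invertible in `k` for `1 ≤ i ≤ p−1`). -/
noncomputable def sElt (B : V →ₗ[k] V →ₗ[k] V) (x y : V) (i : ℕ) : V :=
  (i : k)⁻¹ • ∑ f ∈ Finset.univ.filter
      (fun f : Fin (p - 1) → Bool =>
        (Finset.univ.filter (fun j => f j = true)).card = i - 1),
    sWord p k V B x y f

/-- A restricted Lie algebra structure on the `k`-module `V`, following Jacobson:
a Lie bracket together with a `p`-operation satisfying
`(αx)^{[p]} = α^p x^{[p]}`, `(x+y)^{[p]} = x^{[p]} + y^{[p]} + ∑_{i=1}^{p−1} s_i(x,y)`,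
and `[x, y^{[p]}] = x·(ad y)^p`. -/
structure RLieStr : Type where
  bracket : V →ₗ[k] V →ₗ[k] V
  bracket_self : ∀ x : V, bracket x x = 0
  leibniz : ∀ x y z : V, bracket x (bracket y z)
      = bracket (bracket x y) z + bracket y (bracket x z)
  pMap : V → V
  pMap_smul : ∀ (a : k) (x : V), pMap (a • x) = a ^ p • pMap x
  pMap_add : ∀ x y : V, pMap (x + y)
      = pMap x + pMap y + ∑ i ∈ Finset.Ico 1 p, sElt p k V bracket x y i
  pMap_bracket : ∀ x y : V,
      bracket x (pMap y) = ((bracket.flip y) ^ p : Module.End k V) x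

end Defs

section Rep

variable (p : ℕ) [Fact (Nat.Prime p)] (k : Type) [Field k] [CharP k p]
variable (G V : Type) [AddCommGroup G] [Module k G] [AddCommGroup V] [Module k V]

/-- An algebraic representation of the restricted Lie algebra `g` on the restricted Lie
algebra `h`: (i) `ρ_{[x,y]} = ρ_xρ_y − ρ_yρ_x`; (ii) `ρ_{x^{[p]}} = (ρ_x)^p`;
(iii) `ρ_x([a,b]) = [ρ_x(a), b] + [a, ρ_x(b)]`; (iv) `ρ_x(a^{[p]}) = ρ_x(a)(ad a)^{p−1}`. -/
structure IsAlgebraicRepG (Lg : RLieStr p k G) (Lh : RLieStr p k V)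
    (ρ : G →ₗ[k] Module.End k V) : Prop where
  map_bracket : ∀ x y : G, ρ (Lg.bracket x y) = ρ x * ρ y - ρ y * ρ x
  map_pMap : ∀ x : G, ρ (Lg.pMap x) = ρ x ^ p
  deriv : ∀ (x : G) (a b : V), ρ x (Lh.bracket a b)
      = Lh.bracket (ρ x a) b + Lh.bracket a (ρ x b)
  pow_rule : ∀ (x : G) (a : V), ρ x (Lh.pMap a)
      = ((Lh.bracket.flip a) ^ (p - 1) : Module.End k V) (ρ x a)

/-- The bracket of the semiproduct `h ⋊_ρ g`:
`[a+x, b+y] = [a,b]_h + ρ_x(b) − ρ_y(a) + [x,y]_g`. -/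
noncomputable def semiBr (Lg : RLieStr p k G) (Lh : RLieStr p k V)
    (ρ : G →ₗ[k] Module.End k V) : (V × G) →ₗ[k] (V × G) →ₗ[k] (V × G) :=
  LinearMap.mk₂ k
    (fun u v => (Lh.bracket u.1 v.1 + ρ u.2 v.1 - ρ v.2 u.1, Lg.bracket u.2 v.2))
    (by
      intro u u' v
      refine Prod.ext ?_ ?_ <;>
        simp only [Prod.fst_add, Prod.snd_add, map_add, LinearMap.add_apply] <;> abel)
    (by
      intro c u v
      refine Prod.ext ?_ ?_ <;>
        simp only [Prod.smul_fst, Prod.smul_snd, map_smul, LinearMap.smul_apply,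
          smul_add, smul_sub])
    (by
      intro u v v'
      refine Prod.ext ?_ ?_ <;>
        simp only [Prod.fst_add, Prod.snd_add, map_add, LinearMap.add_apply] <;> abel)
    (by
      intro c u v
      refine Prod.ext ?_ ?_ <;>
        simp only [Prod.smul_fst, Prod.smul_snd, map_smul, LinearMap.smul_apply,
          smul_add, smul_sub])

end Rep

section Aux

open Polynomial

/-- coefficient of `λ^n` in `(λA+B)^m`. -/
noncomputable def tC {R : Type*} [Semiring R] (m n : ℕ) (A B : R) : R :=
  ((C A * X + C B) ^ m : R[X]).coeff n

/-- The operator `∑ Z^j W Z^(m-1-j)`. -/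
def hOp {R : Type*} [Semiring R] (m : ℕ) (Z W : R) : R :=
  ∑ j ∈ Finset.range m, Z ^ j * W * Z ^ (m - 1 - j)

theorem hOp_succ {R : Type*} [Semiring R] (m : ℕ) (Z W : R) :
    hOp (m + 1) Z W = W * Z ^ m + Z * hOp m Z W := by
  unfold hOp
  rw [Finset.sum_range_succ', Finset.mul_sum, add_comm]
  congr 1
  · simp
  · refine Finset.sum_congr rfl fun j hj => ?_
    have : m + 1 - 1 - (j + 1) = m - 1 - j := by omega
    rw [this, pow_succ']
    simp only [mul_assoc]

theorem derivative_pow_nc {R : Type*} [Semiring R] (m : ℕ) (Z : R[X]) :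
    derivative (Z ^ m) = hOp m Z (derivative Z) := by
  induction m with
  | zero => simp [hOp]
  | succ m ih => rw [pow_succ', derivative_mul, ih, hOp_succ]

theorem hOp_map {R S : Type*} [Semiring R] [Semiring S] (f : R →+* S) (m : ℕ) (Z W : R) :
    f (hOp m Z W) = hOp m (f Z) (f W) := by
  simp [hOp]

theorem tC_map {R S : Type*} [Semiring R] [Semiring S] (f : R →+* S) (m n : ℕ) (A B : R) :
    f (tC m n A B) = tC m n (f A) (f B) := by
  unfold tC
  rw [← coeff_map]
  simp

theorem natDegree_lin_pow {R : Type*} [Semiring R] (m : ℕ) (A B : R) :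
    ((C A * X + C B) ^ m : R[X]).natDegree < m + 1 := by
  have h1 : (C A * X + C B : R[X]).natDegree ≤ 1 := natDegree_linear_le
  have := natDegree_pow_le_of_le m h1
  omega

theorem natDegree_tC {R : Type*} [Semiring R] (m n : ℕ) (A B W : R) :
    (tC m n (C A) (C B + C W * X)).natDegree ≤ m := by
  have hB : (C B + C W * X : R[X]).natDegree ≤ 1 := by
    rw [add_comm]; exact natDegree_linear_le
  induction m generalizing n with
  | zero =>
    simp only [tC, pow_zero, coeff_one]
    split_ifs <;> simp
  | succ m ih =>
    cases n with
    | zero =>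
      have : tC (m+1) 0 (C A) (C B + C W * X) =
          tC m 0 (C A) (C B + C W * X) * (C B + C W * X) := by
        simp [tC, pow_succ, mul_add, ← mul_assoc]
      rw [this]
      exact natDegree_mul_le_of_le (ih 0) hB
    | succ n =>
      have : tC (m+1) (n+1) (C A) (C B + C W * X) =
          C A * tC m n (C A) (C B + C W * X) +
          (C B + C W * X) * tC m (n+1) (C A) (C B + C W * X) := by
        unfold tC
        rw [pow_succ', add_mul, coeff_add, coeff_C_mul, mul_assoc, coeff_C_mul, coeff_X_mul]
      rw [this]
      refine natDegree_add_le_of_degree_le ?_ ?_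
      · exact (natDegree_C_mul_le _ _).trans ((ih n).trans (by omega))
      · have := natDegree_mul_le_of_le hB (ih (n+1))
        omega

section Ev
variable {k : Type} [Field k] {R : Type*} [Ring R] [Algebra k R]

/-- evaluation at a central scalar -/
noncomputable def evk (c : k) : R[X] →+* R :=
  eval₂RingHom' (RingHom.id R) (algebraMap k R c) (fun a => (Algebra.commutes c a).symm)

@[simp] theorem evk_C (c : k) (A : R) : evk c (C A) = A := by
  simp [evk, eval₂RingHom']

@[simp] theorem evk_X (c : k) : evk c (X : R[X]) = algebraMap k R c := by
  simp [evk, eval₂RingHom']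

theorem evk_sum (c : k) (q : R[X]) (N : ℕ) (h : q.natDegree < N) :
    evk c q = ∑ n ∈ Finset.range N, c ^ n • q.coeff n := by
  have : evk c q = eval₂ (RingHom.id R) (algebraMap k R c) q := rfl
  rw [this, eval₂_eq_sum_range' _ h]
  refine Finset.sum_congr rfl fun n _ => ?_
  rw [RingHom.id_apply, ← map_pow, ← Algebra.commutes, Algebra.smul_def]

theorem evk_deriv_sum (c : k) (q : R[X]) (N : ℕ) (h : q.natDegree < N) :
    evk c (derivative q) = ∑ n ∈ Finset.range N, ((n : k) * c ^ (n - 1)) • q.coeff n := by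
  have h2 : q = ∑ n ∈ Finset.range N, C (q.coeff n) * X ^ n :=
    as_sum_range_C_mul_X_pow' _ h
  conv_lhs => rw [h2]
  simp only [derivative_sum, map_sum]
  refine Finset.sum_congr rfl fun n _ => ?_
  rw [derivative_C_mul_X_pow, map_mul, map_pow, evk_C, evk_X, ← map_pow, ← Algebra.commutes,
    Algebra.smul_def, map_mul, map_natCast, mul_assoc, ← Nat.cast_comm, ← mul_assoc,
    ← mul_assoc, Nat.cast_comm]

theorem pow_lin (m : ℕ) (c : k) (A B : R) :
    (c • A + B) ^ m = ∑ n ∈ Finset.range (m + 1), c ^ n • tC m n A B := by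
  have := evk_sum c ((C A * X + C B) ^ m : R[X]) (m + 1) (natDegree_lin_pow m A B)
  unfold tC
  rw [← this]
  simp [Algebra.smul_def, Algebra.commutes]

theorem deriv_lin (m : ℕ) (c : k) (A B : R) :
    hOp m (c • A + B) A =
      ∑ n ∈ Finset.range (m + 1), ((n : k) * c ^ (n - 1)) • tC m n A B := by
  have := evk_deriv_sum c ((C A * X + C B) ^ m : R[X]) (m + 1) (natDegree_lin_pow m A B)
  unfold tC
  rw [← this, derivative_pow_nc, hOp_map]
  simp [Algebra.smul_def, Algebra.commutes]

end Ev

theorem word_sum {R : Type*} [Semiring R] (m : ℕ) (A B : R) :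
    ∑ f : Fin m → Bool, C (List.ofFn (fun j => if f j then A else B)).prod *
      X ^ (Finset.univ.filter (fun j => f j = true)).card = ((C A * X + C B) ^ m : R[X]) := by
  induction m with
  | zero => simp
  | succ m ih =>
    rw [← (Fin.consEquiv (fun _ => Bool)).sum_comp, Fintype.sum_prod_type, pow_succ', ← ih,
      Fintype.sum_bool, add_mul, Finset.mul_sum, Finset.mul_sum]
    congr 1 <;> refine Finset.sum_congr rfl fun f _ => ?_
    · simp only [Fin.consEquiv_apply, List.ofFn_succ, Fin.cons_zero, Fin.cons_succ,
        List.prod_cons, Fin.card_filter_univ_succ, if_true, C_mul, pow_succ']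
      simp only [mul_assoc, Function.comp_def, Fin.cons_succ]
      congr 1
      simp only [← mul_assoc, X_mul_C]
    · simp [Fin.consEquiv_apply, List.ofFn_succ,
        List.prod_cons, Fin.card_filter_univ_succ, mul_assoc, Function.comp_def]

theorem word_coeff {R : Type*} [Semiring R] (m n : ℕ) (A B : R) :
    ∑ f ∈ Finset.univ.filter
      (fun f : Fin m → Bool => (Finset.univ.filter (fun j => f j = true)).card = n),
      (List.ofFn (fun j => if f j then A else B)).prod = tC m n A B := by
  unfold tC
  rw [← word_sum, finsetSum_coeff, Finset.sum_filter]
  refine Finset.sum_congr rfl fun f _ => ?_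
  rw [coeff_C_mul, coeff_X_pow]
  by_cases hf : (Finset.univ.filter (fun j => f j = true)).card = n
  · rw [if_pos hf, if_pos hf.symm, mul_one]
  · rw [if_neg hf, if_neg (fun h => hf h.symm), mul_zero]

theorem tC_last {R : Type*} [Semiring R] (m : ℕ) (A B : R) : tC m m A B = A ^ m := by
  unfold tC
  have h1 : (C A * X + C B : R[X]).natDegree ≤ 1 := natDegree_linear_le
  have := coeff_pow_of_natDegree_le (m := m) h1
  simpa using this

theorem tC_zero {R : Type*} [Semiring R] (m : ℕ) (A B : R) : tC m 0 A B = B ^ m := by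
  unfold tC
  induction m with
  | zero => simp
  | succ m ih => rw [pow_succ, mul_coeff_zero, ih]; simp [pow_succ]

section Vec
variable {k : Type} [Field k] {V : Type*} [AddCommGroup V] [Module k V]

theorem vec_uniq [Infinite k] (N : ℕ) (c : ℕ → V)
    (h : ∀ t : k, ∑ n ∈ Finset.range N, t ^ n • c n = 0) : ∀ n < N, c n = 0 := by
  intro n hn
  rw [← Module.forall_dual_apply_eq_zero_iff k]
  intro φ
  have hq : (∑ n ∈ Finset.range N, C (φ (c n)) * X ^ n : k[X]) = 0 := by
    apply Polynomial.funext
    intro t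
    have := congrArg φ (h t)
    simp only [map_sum, map_smul, map_zero, smul_eq_mul] at this
    rw [eval_finsetSum, eval_zero, ← this]
    refine Finset.sum_congr rfl fun n _ => ?_
    rw [eval_C_mul, eval_pow, eval_X, mul_comm]
  have := congrArg (fun q => coeff q n) hq
  simpa [finsetSum_coeff, coeff_X_pow, hn] using this

theorem vec_uniq' [Infinite k] (N : ℕ) (c d : ℕ → V)
    (h : ∀ t : k, ∑ n ∈ Finset.range N, t ^ n • c n = ∑ n ∈ Finset.range N, t ^ n • d n) :
    ∀ n < N, c n = d n := by
  intro n hn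
  have := vec_uniq (k := k) N (fun n => c n - d n) (fun t => by
    simp only [smul_sub, Finset.sum_sub_distrib, h t, sub_self]) n hn
  exact sub_eq_zero.mp this

/-- shifting the derivative sum -/
theorem shift_sum (m : ℕ) (t : k) (c : ℕ → V) :
    ∑ n ∈ Finset.range (m + 1), ((n : k) * t ^ (n - 1)) • c n =
      ∑ n ∈ Finset.range m, t ^ n • (((n + 1 : ℕ) : k) • c (n + 1)) := by
  rw [Finset.sum_range_succ']
  simp only [Nat.cast_zero, zero_mul, zero_smul, add_zero, Nat.add_sub_cancel]
  refine Finset.sum_congr rfl fun n _ => ?_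
  rw [smul_smul, mul_comm]

/-- `g` is a polynomial function of degree `< p` with derivative `g'`. -/
def HD (p : ℕ) (g g' : k → V) : Prop :=
  ∃ c : ℕ → V, ∀ t : k, g t = ∑ n ∈ Finset.range p, t ^ n • c n ∧
    g' t = ∑ n ∈ Finset.range p, ((n : k) * t ^ (n - 1)) • c n

theorem HD.add {p : ℕ} {g g' h h' : k → V} (hg : HD p g g') (hh : HD p h h') :
    HD p (fun t => g t + h t) (fun t => g' t + h' t) := by
  obtain ⟨c, hc⟩ := hg
  obtain ⟨d, hd⟩ := hh
  refine ⟨fun n => c n + d n, fun t => ?_⟩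
  simp only [(hc t).1, (hc t).2, (hd t).1, (hd t).2, smul_add, Finset.sum_add_distrib, and_self]

theorem HD.sub {p : ℕ} {g g' h h' : k → V} (hg : HD p g g') (hh : HD p h h') :
    HD p (fun t => g t - h t) (fun t => g' t - h' t) := by
  obtain ⟨c, hc⟩ := hg
  obtain ⟨d, hd⟩ := hh
  refine ⟨fun n => c n - d n, fun t => ?_⟩
  simp only [(hc t).1, (hc t).2, (hd t).1, (hd t).2, smul_sub, Finset.sum_sub_distrib, and_self]

theorem HD.const [Infinite k] {p : ℕ} [hp : Fact p.Prime] [CharP k p] {g g' : k → V}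
    (hg : HD p g g') (h0 : ∀ t, g' t = 0) : g 1 = g 0 := by
  obtain ⟨c, hc⟩ := hg
  obtain ⟨m, rfl⟩ : ∃ m, p = m + 1 := ⟨p - 1, by have := hp.out.pos; omega⟩
  have h1 : ∀ n < m, ((n + 1 : ℕ) : k) • c (n + 1) = 0 :=
    vec_uniq (k := k) m (fun n => ((n + 1 : ℕ) : k) • c (n + 1)) (fun t => by
      rw [← shift_sum, ← (hc t).2, h0])
  have h2 : ∀ n < m, c (n + 1) = 0 := by
    intro n hn
    refine (smul_eq_zero.mp (h1 n hn)).resolve_left ?_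
    rw [CharP.cast_eq_zero_iff k (m + 1)]
    intro hd
    have := Nat.le_of_dvd (by omega) hd
    omega
  rw [(hc 1).1, (hc 0).1]
  refine Finset.sum_congr rfl fun n hn => ?_
  cases n with
  | zero => simp
  | succ n => rw [h2 n (by simpa using hn)]; simp

theorem HD.of_poly {p : ℕ} (q : (Module.End k V)[X]) (hq : q.natDegree < p) (u : V) :
    HD p (fun t : k => evk t q u) (fun t : k => evk t (derivative q) u) := by
  refine ⟨fun n => q.coeff n u, fun t => ⟨?_, ?_⟩⟩
  · simp only [evk_sum t q p hq, LinearMap.sum_apply, LinearMap.smul_apply]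
  · simp only [evk_deriv_sum t q p hq, LinearMap.sum_apply, LinearMap.smul_apply]

end Vec

section Lie
variable {p : ℕ} [hp : Fact (Nat.Prime p)] {k : Type} [Field k] [CharP k p] [Infinite k]
variable {V : Type} [AddCommGroup V] [Module k V]

/-- right adjoint operator -/
def rad (B : V →ₗ[k] V →ₗ[k] V) (z : V) : Module.End k V := B.flip z

theorem rad_apply (B : V →ₗ[k] V →ₗ[k] V) (z a : V) : rad B z a = B a z := rfl

theorem rad_lin (B : V →ₗ[k] V →ₗ[k] V) (c : k) (u v : V) :
    rad B (c • u + v) = c • rad B u + rad B v := by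
  simp only [rad, map_add, map_smul]

theorem rad_add (B : V →ₗ[k] V →ₗ[k] V) (u v : V) :
    rad B (u + v) = rad B u + rad B v := by
  simp only [rad, map_add]

/-- the sum of the `s_i` -/
noncomputable def sTot (p : ℕ) (B : V →ₗ[k] V →ₗ[k] V) (u v : V) : V :=
  ∑ i ∈ Finset.Ico 1 p, (i : k)⁻¹ • tC (p - 1) (i - 1) (rad B u) (rad B v) u

theorem sTot_eq (B : V →ₗ[k] V →ₗ[k] V) (u v : V) :
    ∑ i ∈ Finset.Ico 1 p, sElt p k V B u v i = sTot p B u v := by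
  unfold sTot
  refine Finset.sum_congr rfl fun i _ => ?_
  unfold sElt sWord
  rw [← word_coeff, LinearMap.sum_apply]
  rfl

theorem antisym {B : V →ₗ[k] V →ₗ[k] V} (hB : ∀ x, B x x = 0) (a b : V) :
    B a b = - B b a := by
  have := hB (a + b)
  simp only [map_add, LinearMap.add_apply, hB, zero_add, add_zero] at this
  rw [add_comm] at this
  exact eq_neg_of_add_eq_zero_left this

theorem rad_bracket {B : V →ₗ[k] V →ₗ[k] V} (hB : ∀ x, B x x = 0)
    (hJ : ∀ x y z, B x (B y z) = B (B x y) z + B y (B x z)) (z a b : V) :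
    rad B z (B a b) = B (rad B z a) b + B a (rad B z b) := by
  simp only [rad_apply]
  rw [hJ a b z, antisym hB b (B a z)]
  abel

theorem hOp_bracket {B : V →ₗ[k] V →ₗ[k] V} (hB : ∀ x, B x x = 0)
    (hJ : ∀ x y z, B x (B y z) = B (B x y) z + B y (B x z)) (m : ℕ) (z a b : V) :
    hOp m (rad B z) (rad B b) a = ∑ q ∈ Finset.range m, (m.choose (q + 1) : k) •
      B ((rad B z ^ (m - 1 - q)) a) ((rad B z ^ q) b) := by
  induction m with
  | zero => simp [hOp]
  | succ m ih =>
    rw [hOp_succ, LinearMap.add_apply, Module.End.mul_apply, Module.End.mul_apply, ih, map_sum]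
    simp only [Nat.choose_succ_succ, Nat.cast_add, add_smul, Finset.sum_add_distrib, map_smul,
      rad_bracket hB hJ, smul_add, Nat.add_sub_cancel]
    rw [Finset.sum_range_succ', Finset.sum_range_succ
      (fun x => ((m.choose (x + 1) : ℕ) : k) • _) m]
    have e1 : ∀ q ∈ Finset.range m, ((m.choose (q + 1) : ℕ) : k) •
        B (rad B z ((rad B z ^ (m - 1 - q)) a)) ((rad B z ^ q) b) =
        ((m.choose (q + 1) : ℕ) : k) • B ((rad B z ^ (m - q)) a) ((rad B z ^ q) b) := by
      intro q hq
      have : m - q = (m - 1 - q) + 1 := by have := Finset.mem_range.mp hq; omega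
      rw [this, pow_succ', Module.End.mul_apply]
    have e2 : ∀ q ∈ Finset.range m, ((m.choose (q + 1) : ℕ) : k) •
        B ((rad B z ^ (m - 1 - q)) a) (rad B z ((rad B z ^ q) b)) =
        ((m.choose (q + 1) : ℕ) : k) • B ((rad B z ^ (m - (q + 1))) a)
          ((rad B z ^ (q + 1)) b) := by
      intro q hq
      have : m - (q + 1) = (m - 1 - q) := by omega
      rw [this, pow_succ' _ q, Module.End.mul_apply]
    rw [Finset.sum_congr rfl e1, Finset.sum_congr rfl e2]
    simp only [Nat.choose_zero_right, Nat.cast_one, one_smul, pow_zero, Module.End.one_apply,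
      Nat.sub_zero, Nat.choose_succ_self, Nat.cast_zero, zero_smul, add_zero, rad_apply]
    abel

theorem cast_choose_p (q : ℕ) (h0 : q ≠ 0) (h : q < p) : ((p.choose q : ℕ) : k) = 0 := by
  rw [CharP.cast_eq_zero_iff k p]
  exact hp.out.dvd_choose_self h0 h

theorem hOp_symm {B : V →ₗ[k] V →ₗ[k] V} (hB : ∀ x, B x x = 0)
    (hJ : ∀ x y z, B x (B y z) = B (B x y) z + B y (B x z)) (z a b : V) :
    hOp (p - 1) (rad B z) (rad B b) a = hOp (p - 1) (rad B z) (rad B a) b := by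
  have h1 := hp.out.one_lt
  rw [hOp_bracket hB hJ, hOp_bracket hB hJ, ← Finset.sum_range_reflect, ← sub_eq_zero,
    ← Finset.sum_sub_distrib]
  refine Finset.sum_eq_zero fun q hq => ?_
  have hq := Finset.mem_range.mp hq
  have i1 : p - 1 - 1 - (p - 1 - 1 - q) = q := by omega
  rw [i1, antisym hB ((rad B z ^ q) a), smul_neg, ← neg_add', neg_eq_zero, ← add_smul,
    ← Nat.cast_add]
  have i2 : (p - 1).choose (p - 1 - 1 - q + 1) = (p - 1).choose q := by
    rw [← Nat.choose_symm (by omega : q ≤ p - 1)]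
    congr 1; omega
  have i3 : (p - 1).choose q + (p - 1).choose (q + 1) = p.choose (q + 1) := by
    rw [← Nat.choose_succ_succ]
    congr 1; omega
  rw [i2, i3, cast_choose_p (q + 1) (by omega) (by omega), zero_smul]

theorem hOp_p {B : V →ₗ[k] V →ₗ[k] V} (hB : ∀ x, B x x = 0)
    (hJ : ∀ x y z, B x (B y z) = B (B x y) z + B y (B x z)) (z a b : V) :
    hOp p (rad B z) (rad B b) a = B a ((rad B z ^ (p - 1)) b) := by
  have h1 := hp.out.one_lt
  rw [hOp_bracket hB hJ, Finset.sum_eq_single (p - 1)]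
  · have : p - 1 + 1 = p := by omega
    simp [this]
  · intro q hq hne
    have := Finset.mem_range.mp hq
    rw [cast_choose_p (q + 1) (by omega) (by omega), zero_smul]
  · intro h
    exact absurd (Finset.mem_range.mpr (by omega)) h

theorem pow_p1_self {B : V →ₗ[k] V →ₗ[k] V} (hB : ∀ x, B x x = 0) (t : k) (u : V) :
    (rad B (t • u) ^ (p - 1)) u = 0 := by
  have h1 := hp.out.one_lt
  have : p - 1 = (p - 2) + 1 := by omega
  rw [this, pow_succ, Module.End.mul_apply, rad_apply, map_smul, hB, smul_zero, map_zero]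

theorem tC_vec (B : V →ₗ[k] V →ₗ[k] V) (c : k) (u v w : V) :
    (rad B (c • u + v) ^ (p - 1)) w =
      ∑ n ∈ Finset.range p, c ^ n • tC (p - 1) n (rad B u) (rad B v) w := by
  have h1 := hp.out.one_lt
  have : p - 1 + 1 = p := by omega
  rw [rad_lin, pow_lin, this]
  simp only [LinearMap.sum_apply, LinearMap.smul_apply]

theorem natCast_inv_ne (i : ℕ) (h0 : 1 ≤ i) (h : i < p) : (i : k) ≠ 0 := by
  intro h2
  rw [CharP.cast_eq_zero_iff k p] at h2
  have := Nat.le_of_dvd (by omega) h2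
  omega

open Finset in
theorem hd_second {B : V →ₗ[k] V →ₗ[k] V} (hB : ∀ x, B x x = 0)
    (hJ : ∀ x y z, B x (B y z) = B (B x y) z + B y (B x z)) (u v w : V) :
    HD p (fun t : k => sTot p B u (v + t • w))
      (fun t : k => (rad B (u + (v + t • w)) ^ (p - 1)) w -
        (rad B (v + t • w) ^ (p - 1)) w) := by
  have h1 := hp.out.one_lt
  have hp1 : p - 1 + 1 = p := by omega
  set Q : ℕ → (Module.End k V)[X] := fun n =>
    tC (p - 1) n (C (rad B u)) (C (rad B v) + C (rad B w) * X) with hQ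
  have hrad : ∀ t : k, rad B (v + t • w) = rad B v + t • rad B w := by
    intro t; rw [add_comm, rad_lin, add_comm]
  have hev : ∀ (t : k) n, evk t (Q n) = tC (p - 1) n (rad B u) (rad B (v + t • w)) := by
    intro t n
    rw [hQ, tC_map, hrad]
    simp [Algebra.smul_def, Algebra.commutes]
  have hder : ∀ (t : k), ∀ n < p - 1, evk t (derivative (Q n)) u =
      ((n + 1 : ℕ) : k) • tC (p - 1) (n + 1) (rad B u) (rad B (v + t • w)) w := by
    intro t n hn
    have key := vec_uniq' (k := k) p (fun n => evk t (derivative (Q n)) u)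
      (fun n => if n < p - 1 then
        ((n + 1 : ℕ) : k) • tC (p - 1) (n + 1) (rad B u) (rad B (v + t • w)) w else 0)
      (fun c => by
        have e1 := pow_lin (k := k) (p - 1) c (C (rad B u)) (C (rad B v) + C (rad B w) * X)
        have e2 := congrArg (fun q : (Module.End k V)[X] => (evk t (derivative q) : Module.End k V) u) e1
        simp only [derivative_pow_nc, hOp_map, derivative_sum, derivative_smul, map_sum,
          LinearMap.sum_apply, hp1] at e2
        have e3 : ∀ x ∈ range p, evk t (c ^ x • derivative
            (tC (p - 1) x (C (rad B u)) (C (rad B v) + C (rad B w) * X))) u =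
            c ^ x • evk t (derivative (Q x)) u := by
          intro x _
          rw [Algebra.smul_def (c ^ x) (derivative _), map_mul,
            Polynomial.algebraMap_apply, evk_C, ← Algebra.smul_def]
          rfl
        rw [sum_congr rfl e3] at e2
        rw [← e2]
        have e4 : evk t (c • C (rad B u) + (C (rad B v) + C (rad B w) * X)) =
            rad B (c • u + (v + t • w)) := by
          rw [rad_lin, hrad]
          simp [Algebra.smul_def, Algebra.commutes]
        have e5 : evk t (derivative (c • C (rad B u) + (C (rad B v) + C (rad B w) * X)))
            = rad B w := by
          simp
        rw [e4, e5, hOp_symm hB hJ, rad_lin, deriv_lin, hp1, LinearMap.sum_apply]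
        have e6 := shift_sum (p - 1) c
          (fun n => tC (p - 1) n (rad B u) (rad B (v + t • w)) w)
        rw [hp1] at e6
        simp only [LinearMap.smul_apply]
        rw [e6, ← hp1, sum_range_succ]
        simp only [hp1, lt_irrefl, if_false, smul_zero, add_zero]
        refine sum_congr rfl fun n hn => ?_
        rw [if_pos (mem_range.mp hn)])
      n (by omega)
    simpa [hn] using key
  have hpoly := HD.of_poly (k := k) (p := p) (∑ i ∈ Ico 1 p, (i : k)⁻¹ • Q (i - 1)) (by
    refine lt_of_le_of_lt (b := p - 1) ?_ (by omega)
    refine natDegree_sum_le_of_forall_le _ _ fun i _ => ?_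
    exact (natDegree_smul_le _ _).trans (natDegree_tC _ _ _ _ _)) u
  have hsm : ∀ (t c : k) (q : (Module.End k V)[X]), evk t (c • q) = c • evk t q := by
    intro t c q
    rw [Algebra.smul_def, map_mul, Polynomial.algebraMap_apply, evk_C, ← Algebra.smul_def]
  convert hpoly using 2 with t t
  · simp only [map_sum, hsm, hev, LinearMap.sum_apply, LinearMap.smul_apply]
    rfl
  · simp only [derivative_sum, derivative_smul, map_sum, hsm, LinearMap.sum_apply,
      LinearMap.smul_apply]
    have := tC_vec (p := p) B 1 u (v + t • w) w
    simp only [one_smul, one_pow] at this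
    rw [this, range_eq_Ico, sum_eq_sum_Ico_succ_bot (by omega), tC_zero, add_sub_cancel_left]
    refine sum_congr rfl fun i hi => ?_
    have hi := mem_Ico.mp hi
    have hi1 : i - 1 + 1 = i := by omega
    rw [hder t (i - 1) (by omega), hi1, smul_smul, inv_mul_cancel₀ (natCast_inv_ne i hi.1 hi.2),
      one_smul]

theorem sTot_zero_left (B : V →ₗ[k] V →ₗ[k] V) (v : V) : sTot p B 0 v = 0 := by
  simp [sTot]

theorem sTot_zero_right {B : V →ₗ[k] V →ₗ[k] V} (hB : ∀ x, B x x = 0) (u : V) :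
    sTot p B u 0 = 0 := by
  have h1 := hp.out.one_lt
  have key := vec_uniq (k := k) p (fun n => tC (p - 1) n (rad B u) (rad B 0) u) (fun t => by
    rw [← tC_vec, add_zero, pow_p1_self hB])
  unfold sTot
  refine Finset.sum_eq_zero fun i hi => ?_
  have := Finset.mem_Ico.mp hi
  rw [key (i - 1) (by omega), smul_zero]

theorem tC_smul {R : Type*} [Ring R] [Algebra k R] (m n : ℕ) (c : k) (A B : R) :
    tC m n (c • A) (c • B) = c ^ m • tC m n A B := by
  unfold tC
  have : (C (c • A) * X + C (c • B) : R[X]) = c • (C A * X + C B) := by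
    rw [smul_add, smul_C, ← smul_mul_assoc, smul_C]
  rw [this, _root_.smul_pow, coeff_smul]

theorem tC_smul_left {R : Type*} [Ring R] [Algebra k R] (m n : ℕ) (c : k) (A B : R) :
    tC m n (c • A) B = c ^ n • tC m n A B := by
  by_cases hn : n < m + 1
  · refine vec_uniq' (k := k) (m + 1) (fun n => tC m n (c • A) B)
      (fun n => c ^ n • tC m n A B) (fun t => ?_) n hn
    rw [← pow_lin, smul_smul, pow_lin]
    refine Finset.sum_congr rfl fun j _ => ?_
    rw [smul_smul, mul_pow]
  · unfold tC
    rw [coeff_eq_zero_of_natDegree_lt, coeff_eq_zero_of_natDegree_lt, smul_zero]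
    · have := natDegree_lin_pow m A B; omega
    · have := natDegree_lin_pow m (c • A) B; omega

theorem rad_smul (B : V →ₗ[k] V →ₗ[k] V) (c : k) (u : V) :
    rad B (c • u) = c • rad B u := by
  simp only [rad, map_smul]

theorem sTot_smul (B : V →ₗ[k] V →ₗ[k] V) (c : k) (u v : V) :
    sTot p B (c • u) (c • v) = c ^ p • sTot p B u v := by
  have h1 := hp.out.one_lt
  have hp1 : p = p - 1 + 1 := by omega
  unfold sTot
  rw [Finset.smul_sum]
  refine Finset.sum_congr rfl fun i _ => ?_
  rw [rad_smul, rad_smul, tC_smul, LinearMap.smul_apply, map_smul, smul_smul, smul_smul,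
    smul_smul]
  congr 1
  have e : c ^ p = c ^ (p - 1) * c := by rw [← pow_succ, ← hp1]
  rw [e]
  ring

theorem sTot_symm {B : V →ₗ[k] V →ₗ[k] V} (hB : ∀ x, B x x = 0)
    (hJ : ∀ x y z, B x (B y z) = B (B x y) z + B y (B x z)) (u v : V) :
    sTot p B u v = sTot p B v u := by
  have h1 := hp.out.one_lt
  have hp1 : p - 1 + 1 = p := by omega
  have hL := hd_second (p := p) hB hJ u 0 v
  have hR : HD p (fun t : k => sTot p B (t • v) u)
      (fun t : k => (rad B (t • v + u) ^ (p - 1)) v) := by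
    refine ⟨fun n => if n = 0 then 0 else
      (n : k)⁻¹ • tC (p - 1) (n - 1) (rad B v) (rad B u) v, fun t => ⟨?_, ?_⟩⟩
    · rw [Finset.range_eq_Ico, Finset.sum_eq_sum_Ico_succ_bot (by omega)]
      simp only [if_true, smul_zero, zero_add]
      unfold sTot
      refine Finset.sum_congr rfl fun i hi => ?_
      have hi := Finset.mem_Ico.mp hi
      have hi1 : i = i - 1 + 1 := by omega
      rw [if_neg (by omega), rad_smul, tC_smul_left, LinearMap.smul_apply, map_smul, smul_smul,
        smul_smul, smul_smul]
      congr 1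
      have e : t ^ i = t ^ (i - 1) * t := by rw [← pow_succ, ← hi1]
      rw [e]
      ring
    · have e6 := shift_sum (p - 1) t (fun n => if n = 0 then 0 else
        (n : k)⁻¹ • tC (p - 1) (n - 1) (rad B v) (rad B u) v)
      rw [hp1] at e6
      have e7 : ∀ f : ℕ → V, ∑ n ∈ Finset.range p, f n =
          ∑ n ∈ Finset.range (p - 1), f n + f (p - 1) := by
        intro f
        rw [← Finset.sum_range_succ, hp1]
      rw [e6]
      beta_reduce
      rw [tC_vec, e7, tC_last]
      have := pow_p1_self (p := p) hB 1 v
      rw [one_smul] at this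
      rw [this, smul_zero, add_zero]
      refine Finset.sum_congr rfl fun n hn => ?_
      have hn := Finset.mem_range.mp hn
      rw [if_neg (by omega), smul_smul ((n + 1 : ℕ) : k),
        mul_inv_cancel₀ (natCast_inv_ne (p := p) (n + 1) (by omega) (by omega)), one_smul,
        Nat.add_sub_cancel]
  have := (hL.sub hR).const (fun t => by
    simp only [zero_add]
    rw [pow_p1_self hB, sub_zero, add_comm u, sub_self])
  simp only [zero_add, one_smul, zero_smul, sTot_zero_left, sTot_zero_right hB, sub_self] at this
  exact sub_eq_zero.mp this

theorem sTot_cocycle {B : V →ₗ[k] V →ₗ[k] V} (hB : ∀ x, B x x = 0)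
    (hJ : ∀ x y z, B x (B y z) = B (B x y) z + B y (B x z)) (a b x : V) :
    sTot p B b a + sTot p B x (b + a) = sTot p B x a + sTot p B b (x + a) := by
  have h := (((hd_second (p := p) hB hJ b 0 a).add (hd_second (p := p) hB hJ x b a)).sub
    (hd_second (p := p) hB hJ x 0 a)).sub (hd_second (p := p) hB hJ b x a)
  have := h.const (fun t => by
    simp only [zero_add, pow_p1_self hB, sub_zero]
    rw [show x + (b + t • a) = b + (x + t • a) by abel]
    abel)
  simp only [zero_add, one_smul, zero_smul, add_zero, sTot_zero_right hB, sub_zero] at this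
  rw [sTot_symm hB hJ x b, sub_self, sub_sub] at this
  exact sub_eq_zero.mp this

theorem sTot_four {B : V →ₗ[k] V →ₗ[k] V} (hB : ∀ x, B x x = 0)
    (hJ : ∀ x y z, B x (B y z) = B (B x y) z + B y (B x z)) (a b x y : V) :
    sTot p B a b + sTot p B x y + sTot p B (a + b) (x + y) =
      sTot p B a x + sTot p B b y + sTot p B (a + x) (b + y) := by
  have h := (((hd_second (p := p) hB hJ x 0 y).add
    (hd_second (p := p) hB hJ (a + b) x y)).sub
    (hd_second (p := p) hB hJ b 0 y)).sub (hd_second (p := p) hB hJ (a + x) b y)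
  have h2 := h.const (fun t => by
    simp only [zero_add, pow_p1_self hB, sub_zero]
    rw [show a + b + (x + t • y) = a + x + (b + t • y) by abel]
    abel)
  simp only [zero_add, one_smul, zero_smul, add_zero, sTot_zero_right hB, sub_zero] at h2
  have h3 := sTot_cocycle (p := p) hB hJ a b x
  rw [sTot_symm hB hJ b a, sTot_symm hB hJ x a, sTot_symm hB hJ x (b + a),
    sTot_symm hB hJ b (x + a), add_comm b a, add_comm x a] at h3
  have h4 : sTot p B (a + b) x = sTot p B a x + sTot p B (a + x) b - sTot p B a b := by
    rw [← h3]; abel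
  rw [h4] at h2
  have h5 : sTot p B x y = (sTot p B a x + sTot p B (a + x) b - sTot p B a b
    - sTot p B (a + x) b) - sTot p B (a + b) (x + y) + sTot p B b y
      + sTot p B (a + x) (b + y) := by
    rw [← h2]; abel
  rw [h5]; abel

theorem rad_sTot {B : V →ₗ[k] V →ₗ[k] V} (hB : ∀ x, B x x = 0)
    (hJ : ∀ x y z, B x (B y z) = B (B x y) z + B y (B x z)) (u v : V) :
    rad B (u + v) ^ p = rad B u ^ p + rad B v ^ p + rad B (sTot p B u v) := by
  have h1 := hp.out.one_lt
  have hp1 : p - 1 + 1 = p := by omega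
  ext q
  have key : ∀ n < p, B q (tC (p - 1) n (rad B u) (rad B v) u) =
      ((n + 1 : ℕ) : k) • tC p (n + 1) (rad B u) (rad B v) q :=
    vec_uniq' (k := k) p _ _ (fun t => by
      have e := congrArg (B q) (tC_vec (p := p) B t u v u)
      simp only [map_sum, map_smul] at e
      rw [← e, ← hOp_p hB hJ, rad_lin, deriv_lin, LinearMap.sum_apply]
      simp only [LinearMap.smul_apply]
      exact shift_sum p t (fun n => tC p n (rad B u) (rad B v) q))
  have h2 := pow_lin (k := k) p 1 (rad B u) (rad B v)
  simp only [one_smul, one_pow] at h2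
  rw [rad_add, h2, Finset.sum_range_succ, Finset.range_eq_Ico,
    Finset.sum_eq_sum_Ico_succ_bot (by omega), tC_zero, tC_last]
  have h3 : (∑ n ∈ Finset.Ico (0 + 1) p, tC p n (rad B u) (rad B v)) q =
      rad B (sTot p B u v) q := by
    rw [LinearMap.sum_apply, rad_apply]
    unfold sTot
    rw [map_sum]
    refine Finset.sum_congr rfl fun i hi => ?_
    have hi := Finset.mem_Ico.mp hi
    have hi1 : i - 1 + 1 = i := by omega
    rw [map_smul, key (i - 1) (by omega), hi1, smul_smul,
      inv_mul_cancel₀ (natCast_inv_ne i (by omega) hi.2), one_smul]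
  simp only [LinearMap.add_apply, h3]
  abel

end Lie

theorem sTot_hom {p : ℕ} {k : Type} [Field k] [Infinite k]
    {V W : Type} [AddCommGroup V] [Module k V] [AddCommGroup W] [Module k W]
    (hp : 0 < p)
    (B : V →ₗ[k] V →ₗ[k] V) (B' : W →ₗ[k] W →ₗ[k] W) (φ : V →ₗ[k] W)
    (h : ∀ a b, φ (B a b) = B' (φ a) (φ b)) (u v : V) :
    φ (sTot p B u v) = sTot p B' (φ u) (φ v) := by
  have hp1 : p - 1 + 1 = p := by omega
  have hpow : ∀ (m : ℕ) (z w : V), φ ((rad B z ^ m) w) = (rad B' (φ z) ^ m) (φ w) := by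
    intro m z w
    induction m with
    | zero => simp
    | succ m ih => rw [pow_succ', pow_succ', Module.End.mul_apply, Module.End.mul_apply, rad_apply,
        rad_apply, h, ih]
  have key : ∀ n < p, φ (tC (p - 1) n (rad B u) (rad B v) u) =
      tC (p - 1) n (rad B' (φ u)) (rad B' (φ v)) (φ u) :=
    vec_uniq' (k := k) p _ _ (fun t => by
      have e1 := congrArg (fun f : Module.End k V => φ (f u))
        (pow_lin (k := k) (p - 1) t (rad B u) (rad B v))
      have e2 := congrArg (fun f : Module.End k W => f (φ u))
        (pow_lin (k := k) (p - 1) t (rad B' (φ u)) (rad B' (φ v)))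
      simp only [LinearMap.sum_apply, LinearMap.smul_apply, map_sum, map_smul, hp1] at e1 e2
      rw [← e1, ← e2, ← rad_lin, ← rad_lin, hpow, map_add, map_smul])
  unfold sTot
  rw [map_sum]
  refine Finset.sum_congr rfl fun i hi => ?_
  have hi := Finset.mem_Ico.mp hi
  rw [map_smul, key (i - 1) (by omega)]

end Aux

section Semi
variable {p : ℕ} [hp : Fact (Nat.Prime p)] {k : Type} [Field k] [CharP k p] [Infinite k]
variable {G V : Type} [AddCommGroup G] [Module k G] [AddCommGroup V] [Module k V]

theorem semiBr_apply (Lg : RLieStr p k G) (Lh : RLieStr p k V) (ρ : G →ₗ[k] Module.End k V)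
    (u v : V × G) : semiBr p k G V Lg Lh ρ u v =
      (Lh.bracket u.1 v.1 + ρ u.2 v.1 - ρ v.2 u.1, Lg.bracket u.2 v.2) := rfl

theorem pMap_zero' (L : RLieStr p k V) : L.pMap 0 = 0 := by
  have := L.pMap_smul 0 0
  rwa [zero_smul, zero_pow hp.out.ne_zero, zero_smul] at this

theorem rad_pow_inl (Lg : RLieStr p k G) (Lh : RLieStr p k V) (ρ : G →ₗ[k] Module.End k V)
    (m : ℕ) (a b : V) : (rad (semiBr p k G V Lg Lh ρ) (a, 0) ^ m) (b, 0) =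
      ((rad Lh.bracket a ^ m) b, 0) := by
  induction m with
  | zero => simp
  | succ m ih =>
    rw [pow_succ', Module.End.mul_apply, ih, pow_succ', Module.End.mul_apply]
    simp [rad_apply, semiBr_apply]

theorem rad_pow_inr (Lg : RLieStr p k G) (Lh : RLieStr p k V) (ρ : G →ₗ[k] Module.End k V)
    (m : ℕ) (x : G) (b : V) (y : G) : (rad (semiBr p k G V Lg Lh ρ) (0, x) ^ m) (b, y) =
      (((- ρ x) ^ m) b, (rad Lg.bracket x ^ m) y) := by
  induction m with
  | zero => simp
  | succ m ih =>
    rw [pow_succ', Module.End.mul_apply, ih, pow_succ', Module.End.mul_apply, pow_succ',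
      Module.End.mul_apply]
    simp [rad_apply, semiBr_apply]

theorem neg_pow_p (f : Module.End k V) : (- f) ^ p = - f ^ p := by
  have h : (-1 : k) ^ p = -1 := neg_one_pow_char k p
  have : - f = (-1 : k) • f := by simp
  rw [this, _root_.smul_pow, h]
  simp

theorem rad_inl (Lg : RLieStr p k G) (Lh : RLieStr p k V) (ρ : G →ₗ[k] Module.End k V)
    (h : IsAlgebraicRepG p k G V Lg Lh ρ) (a : V) :
    rad (semiBr p k G V Lg Lh ρ) (Lh.pMap a, 0) =
      rad (semiBr p k G V Lg Lh ρ) (a, 0) ^ p := by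
  have hp1 : p = p - 1 + 1 := by have := hp.out.one_lt; omega
  refine LinearMap.ext fun q => ?_
  obtain ⟨b, y⟩ := q
  have e1 : ((b, y) : V × G) = (b, 0) + (0, y) := by simp
  have e2 : rad (semiBr p k G V Lg Lh ρ) (a, 0) (0, y) = (ρ y a, 0) := by
    simp [rad_apply, semiBr_apply]
  have e3 : (rad (semiBr p k G V Lg Lh ρ) (a, 0) ^ p) (0, y) =
      ((rad Lh.bracket a ^ (p - 1)) (ρ y a), 0) := by
    rw [← rad_pow_inl Lg Lh ρ, ← e2, ← Module.End.mul_apply, ← pow_succ, ← hp1]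
  rw [e1, map_add, map_add, e3, rad_pow_inl]
  have e4 := h.pow_rule y a
  have e5 := Lh.pMap_bracket b a
  unfold rad at *
  rw [← e4, ← e5]
  simp [semiBr_apply]

theorem rad_inr (Lg : RLieStr p k G) (Lh : RLieStr p k V) (ρ : G →ₗ[k] Module.End k V)
    (h : IsAlgebraicRepG p k G V Lg Lh ρ) (x : G) :
    rad (semiBr p k G V Lg Lh ρ) (0, Lg.pMap x) =
      rad (semiBr p k G V Lg Lh ρ) (0, x) ^ p := by
  refine LinearMap.ext fun q => ?_
  obtain ⟨b, y⟩ := q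
  rw [rad_pow_inr, neg_pow_p, ← h.map_pMap]
  have e5 := Lg.pMap_bracket y x
  unfold rad at *
  rw [← e5]
  simp [semiBr_apply]

theorem semiBr_self (Lg : RLieStr p k G) (Lh : RLieStr p k V) (ρ : G →ₗ[k] Module.End k V)
    (u : V × G) : semiBr p k G V Lg Lh ρ u u = 0 := by
  simp [semiBr_apply, Lg.bracket_self, Lh.bracket_self]

theorem semiBr_leibniz (Lg : RLieStr p k G) (Lh : RLieStr p k V) (ρ : G →ₗ[k] Module.End k V)
    (h : IsAlgebraicRepG p k G V Lg Lh ρ) (u v w : V × G) :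
    semiBr p k G V Lg Lh ρ u (semiBr p k G V Lg Lh ρ v w) =
      semiBr p k G V Lg Lh ρ (semiBr p k G V Lg Lh ρ u v) w +
      semiBr p k G V Lg Lh ρ v (semiBr p k G V Lg Lh ρ u w) := by
  obtain ⟨a, x⟩ := u
  obtain ⟨b, y⟩ := v
  obtain ⟨c, z⟩ := w
  simp only [semiBr_apply, Prod.mk_add_mk, Prod.mk.injEq]
  refine ⟨?_, Lg.leibniz x y z⟩
  simp only [map_add, map_sub, LinearMap.add_apply, LinearMap.sub_apply, h.map_bracket, h.deriv,
    Lh.leibniz a b c, Module.End.mul_apply]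
  rw [antisym Lh.bracket_self (ρ z a) b]
  abel

end Semi

open PD1 in
/-- Let `g`, `h` be restricted Lie algebras over `k` and
`ρ : g → End_k(h)` a linear map.  The semiproduct `h ⋊_ρ g` (on `h ⊕ g`, with the
prescribed bracket, restricted map restricting to those of `h` and `g`, and mixed
`p`-th powers forced by the restricted‑Lie axioms) is a well-defined restricted Lie
algebra if and only if `ρ` is an algebraic representation of `g` on `h`. -/
theorem semiproduct_wellDefined_iff_algebraicRep
    (p : ℕ) [Fact (Nat.Prime p)] (k : Type) [Field k] [CharP k p] [IsAlgClosed k]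
    (G V : Type) [AddCommGroup G] [Module k G] [AddCommGroup V] [Module k V]
    (Lg : RLieStr p k G) (Lh : RLieStr p k V)
    (ρ : G →ₗ[k] Module.End k V) :
    (∃ S : RLieStr p k (V × G),
        S.bracket = semiBr p k G V Lg Lh ρ ∧
        (∀ a : V, S.pMap (a, 0) = (Lh.pMap a, 0)) ∧
        (∀ x : G, S.pMap (0, x) = (0, Lg.pMap x)))
      ↔ IsAlgebraicRepG p k G V Lg Lh ρ := by
  haveI : Infinite k := IsAlgClosed.instInfinite
  have hp0 : 0 < p := (Fact.out : p.Prime).pos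
  have hp1 : p = p - 1 + 1 := by omega
  constructor
  · rintro ⟨S, hS, hSh, hSg⟩
    have hJ := S.leibniz
    have hP := S.pMap_bracket
    rw [hS] at hJ hP
    refine ⟨fun x y => ?_, fun x => ?_, fun x a b => ?_, fun x a => ?_⟩
    · refine LinearMap.ext fun c => ?_
      have := hJ (0, x) (0, y) (c, 0)
      simp [semiBr_apply] at this
      rw [LinearMap.sub_apply, Module.End.mul_apply, Module.End.mul_apply, this]
      abel
    · refine LinearMap.ext fun c => ?_
      have := hP (c, 0) (0, x)
      have h2 := rad_pow_inr Lg Lh ρ p x c 0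
      unfold rad at h2
      rw [hSg, h2, neg_pow_p] at this
      simpa [semiBr_apply] using this
    · have := hJ (0, x) (a, 0) (b, 0)
      simpa [semiBr_apply] using this
    · have := hP (0, x) (a, 0)
      have e2 : rad (semiBr p k G V Lg Lh ρ) (a, 0) (0, x) = (ρ x a, 0) := by
        simp [rad_apply, semiBr_apply]
      have e3 : (rad (semiBr p k G V Lg Lh ρ) (a, 0) ^ p) (0, x) =
          ((rad Lh.bracket a ^ (p - 1)) (ρ x a), 0) := by
        rw [← rad_pow_inl Lg Lh ρ, ← e2, ← Module.End.mul_apply, ← pow_succ, ← hp1]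
      unfold rad at e3
      rw [hSh, e3] at this
      simpa [semiBr_apply] using this
  · intro h
    have hB := semiBr_self Lg Lh ρ
    have hJ := semiBr_leibniz Lg Lh ρ h
    have hl : ∀ a b, ((sTot p Lh.bracket a b, 0) : V × G) =
        sTot p (semiBr p k G V Lg Lh ρ) (a, 0) (b, 0) := fun a b =>
      sTot_hom hp0 Lh.bracket (semiBr p k G V Lg Lh ρ) (LinearMap.inl k V G)
        (fun a b => by simp [semiBr_apply]) a b
    have hr : ∀ x y, ((0, sTot p Lg.bracket x y) : V × G) =
        sTot p (semiBr p k G V Lg Lh ρ) (0, x) (0, y) := fun a b =>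
      sTot_hom hp0 Lg.bracket (semiBr p k G V Lg Lh ρ) (LinearMap.inr k V G)
        (fun a b => by simp [semiBr_apply]) a b
    refine ⟨⟨semiBr p k G V Lg Lh ρ, hB, hJ, fun u => (Lh.pMap u.1, 0) + (0, Lg.pMap u.2) +
        sTot p (semiBr p k G V Lg Lh ρ) (u.1, 0) (0, u.2), ?_, ?_, ?_⟩, rfl, ?_, ?_⟩
    · rintro c ⟨a, x⟩
      have := sTot_smul (p := p) (semiBr p k G V Lg Lh ρ) c (a, 0) (0, x)
      simp only [Prod.smul_mk, smul_zero] at this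
      simp only [Prod.smul_mk, Lh.pMap_smul, Lg.pMap_smul, smul_add, smul_zero, this]
    · rintro ⟨a, x⟩ ⟨b, y⟩
      have h4 := sTot_four (p := p) hB hJ (a, 0) (b, 0) (0, x) (0, y)
      rw [← hl, ← hr] at h4
      simp only [Prod.mk_add_mk, add_zero, zero_add] at h4
      have e1 : sTot p (semiBr p k G V Lg Lh ρ) (a + b, 0) (0, x + y) =
          sTot p (semiBr p k G V Lg Lh ρ) (a, 0) (0, x) +
          sTot p (semiBr p k G V Lg Lh ρ) (b, 0) (0, y) +
          sTot p (semiBr p k G V Lg Lh ρ) (a, x) (b, y) -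
          (sTot p Lh.bracket a b, sTot p Lg.bracket x y) := by
        rw [← h4]; abel
      simp only [sTot_eq, Prod.mk_add_mk, e1, Lh.pMap_add, Lg.pMap_add]
      ext <;> simp <;> abel
    · rintro q ⟨a, x⟩
      have h4 := rad_sTot (p := p) hB hJ (a, 0) (0, x)
      rw [← rad_inl Lg Lh ρ h, ← rad_inr Lg Lh ρ h, ← rad_add, ← rad_add] at h4
      simp only [Prod.mk_add_mk, add_zero, zero_add] at h4 ⊢
      have h5 := congrArg (fun f : Module.End k (V × G) => f q) h4
      exact h5.symm
    · intro a
      have : ((0, 0) : V × G) = 0 := rfl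
      simp [pMap_zero', this, sTot_zero_right hB]
    · intro x
      have : ((0, 0) : V × G) = 0 := rfl
      simp [pMap_zero', this, sTot_zero_left]

end PD1
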